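/- Let A ⊂ ℝ^4 be a 3-dimensional linear subspace containing a vector w = (1, w₁, w₂, w₃) for which there is a constant c > 0 with max_{1≤i≤3} ‖w_i q‖ ≥ c·q^{−1/3} for every positive integer q (here ‖ξ‖ is the distance from ξ to the nearest integer). Then for every β > 5/3 and Lebesgue-almost every Θ ∈ ℝ^{1×2}, there exists ρ > 0 such that the 2-dimensional subspace C(Θ) ⊂ A satisfies dist(z, C(Θ)) ≥ ρ·|z|^{−β} for every nonzero z ∈ ℤ^4, i.e. almost all 2-dimensional subspaces of A are ρT^{−β}-badly approximable. -/

import Mathlib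

open MeasureTheory Filter

noncomputable section

/-- The sup-norm of a vector in Euclidean space. -/
def supNorm {d : ℕ} (w : EuclideanSpace ℝ (Fin d)) : ℝ := ⨆ i, |w i|

/-- The point of `ℝ^d` (with Euclidean metric) corresponding to an integer vector. -/
def intVec {d : ℕ} (z : Fin d → ℤ) : EuclideanSpace ℝ (Fin d) :=
  (WithLp.equiv 2 (Fin d → ℝ)).symm (fun i => (z i : ℝ))

/-- The irrationality measure function `ψ_B` of a linear subspace of `ℝ^d`:
`ψ_B(t) = inf { dist(z, B) : z ∈ ℤ^d, 1 ≤ |z| < t }`. -/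
def psiSub {d : ℕ} (B : Submodule ℝ (EuclideanSpace ℝ (Fin d))) (t : ℝ) : ℝ :=
  sInf ((fun z : Fin d → ℤ =>
      Metric.infDist (intVec z) (B : Set (EuclideanSpace ℝ (Fin d)))) ''
    {z | 1 ≤ supNorm (intVec z) ∧ supNorm (intVec z) < t})

/-- The Diophantine exponent of a linear subspace of `ℝ^d`:
`ω(B) = sup { γ : liminf_{t→∞} t^γ ψ_B(t) < ∞ }`, as an extended real number. -/
def diophExp {d : ℕ} (B : Submodule ℝ (EuclideanSpace ℝ (Fin d))) : EReal :=
  sSup {x : EReal | ∃ γ : ℝ, x = (γ : EReal) ∧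
    Filter.liminf (fun t : ℝ => ENNReal.ofReal (t ^ γ * psiSub B t)) Filter.atTop < ⊤}

/-- The graph subspace `C(Θ)` of an `(a-c)×c` matrix `Θ`, relative to an orthonormal
basis `e` of an `a`-dimensional subspace of `ℝ^d`:
`C(Θ) = { ∑ x_j e_j + ∑_i (∑_j θ_{ij} x_j) e_{c+i} : x ∈ ℝ^c }`. -/
def graphSub (d a c : ℕ) (hca : c ≤ a) (e : Fin a → EuclideanSpace ℝ (Fin d))
    (Θ : Fin (a - c) → Fin c → ℝ) : Submodule ℝ (EuclideanSpace ℝ (Fin d)) :=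
  Submodule.span ℝ {v | ∃ x : Fin c → ℝ,
    v = (∑ j : Fin c, x j • e (Fin.castLE hca j)) +
        ∑ i : Fin (a - c), (∑ j : Fin c, Θ i j * x j) • e ⟨c + i.1, by have := i.2; omega⟩}

/-- Distance from a real number to the nearest integer. -/
def distToInt (ξ : ℝ) : ℝ := |ξ - round ξ|

theorem isClosed_strip_prod (a b y η R : ℝ) :
    IsClosed {p : ℝ × ℝ | |p.2| ≤ R ∧ |y - a * p.1 - b * p.2| ≤ η} := by
  have h1 : IsClosed {p : ℝ × ℝ | |p.2| ≤ R} := isClosed_le (by fun_prop) (by fun_prop)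
  have h2 : IsClosed {p : ℝ × ℝ | |y - a * p.1 - b * p.2| ≤ η} :=
    isClosed_le (by fun_prop) (by fun_prop)
  exact h1.inter h2

theorem volume_strip_prod_le {a b y η m R : ℝ} (hm : 0 < m) (ha : m ≤ |a|)
    (hη : 0 ≤ η) :
    volume {p : ℝ × ℝ | |p.2| ≤ R ∧ |y - a * p.1 - b * p.2| ≤ η} ≤
      ENNReal.ofReal (4 * R * η / m) := by
  have hclosed : IsClosed {p : ℝ × ℝ | |p.2| ≤ R ∧ |y - a * p.1 - b * p.2| ≤ η} :=
    isClosed_strip_prod a b y η R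
  have ha0 : 0 < |a| := hm.trans_le ha
  rw [Measure.volume_eq_prod, Measure.prod_apply_symm hclosed.measurableSet]
  calc ∫⁻ t, volume ((fun s => (s, t)) ⁻¹' {p : ℝ × ℝ | |p.2| ≤ R ∧ |y - a * p.1 - b * p.2| ≤ η})
      ≤ ∫⁻ t, (Set.Icc (-R) R).indicator (fun _ => ENNReal.ofReal (2 * η / m)) t := by
        refine lintegral_mono fun t => ?_
        by_cases ht : t ∈ Set.Icc (-R) R
        · rw [Set.indicator_of_mem ht]
          refine (measure_mono (t := Metric.closedBall ((y - b * t) / a) (η / m)) ?_).trans ?_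
          · rintro s ⟨-, hs⟩
            simp only [Metric.mem_closedBall, Real.dist_eq] at hs ⊢
            have h1 : s - (y - b * t) / a = -(y - a * s - b * t) / a := by
              field_simp [abs_pos.1 ha0]
              ring
            rw [h1, abs_div, abs_neg]
            exact div_le_div₀ hη hs hm ha
          · rw [Real.volume_closedBall, mul_div_assoc]
        · rw [Set.indicator_of_notMem ht, nonpos_iff_eq_zero]
          convert measure_empty (μ := (volume : Measure ℝ))
          ext s
          simp only [Set.mem_preimage, Set.mem_ofPred_eq, Set.mem_empty_iff_false, iff_false]
          exact fun h => ht (abs_le.1 h.1)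
    _ = ENNReal.ofReal (4 * R * η / m) := by
        rw [lintegral_indicator_const measurableSet_Icc, Real.volume_Icc,
          ← ENNReal.ofReal_mul (by positivity)]
        congr 1
        ring

theorem volume_strip_le {a b y η m R : ℝ} (hm : 0 < m) (hη : 0 ≤ η) :
    volume {Θ : Fin (3 - 2) → Fin 2 → ℝ | m ≤ max |a| |b| ∧ (∀ j, |Θ 0 j| ≤ R) ∧
      |y - a * Θ 0 0 - b * Θ 0 1| ≤ η} ≤ ENNReal.ofReal (4 * R * η / m) := by
  have hmp : MeasurePreserving
      (fun Θ : Fin (3 - 2) → Fin 2 → ℝ => ((Θ 0 0, Θ 0 1) : ℝ × ℝ)) volume volume :=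
    (volume_preserving_piFinTwo (fun _ : Fin 2 => ℝ)).comp
      (volume_preserving_funUnique (Fin 1) (Fin 2 → ℝ))
  by_cases h : m ≤ max |a| |b|
  · rcases le_max_iff.1 h with ha | hb
    · refine le_trans ?_ (volume_strip_prod_le (b := b) (y := y) hm ha hη)
      rw [← hmp.measure_preimage (isClosed_strip_prod a b y η R).nullMeasurableSet]
      exact measure_mono fun Θ hΘ => ⟨hΘ.2.1 1, hΘ.2.2⟩
    · refine le_trans ?_ (volume_strip_prod_le (b := a) (y := y) hm hb hη)
      rw [Measure.volume_eq_prod ℝ ℝ, ← (Measure.measurePreserving_swap.comp hmp).measure_preimage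
        (isClosed_strip_prod b a y η R).nullMeasurableSet]
      refine measure_mono fun Θ hΘ => ⟨hΘ.2.1 0, ?_⟩
      simpa [sub_right_comm] using hΘ.2.2
  · simp [h]

theorem exists_coords_of_mem_graphSub {e : Fin 3 → EuclideanSpace ℝ (Fin 4)}
    {Θ : Fin (3 - 2) → Fin 2 → ℝ} {v : EuclideanSpace ℝ (Fin 4)}
    (hv : v ∈ graphSub 4 3 2 (by omega) e Θ) :
    ∃ s t : ℝ, v = s • e 0 + t • e 1 + (Θ 0 0 * s + Θ 0 1 * t) • e 2 := by
  induction hv using Submodule.span_induction with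
  | mem v hv =>
    obtain ⟨x, rfl⟩ := hv
    refine ⟨x 0, x 1, ?_⟩
    simp [Fin.sum_univ_two]
  | zero => exact ⟨0, 0, by simp⟩
  | add u v _ _ hu hv =>
    obtain ⟨s, t, rfl⟩ := hu
    obtain ⟨s', t', rfl⟩ := hv
    exact ⟨s + s', t + t', by module⟩
  | smul r u _ hu =>
    obtain ⟨s, t, rfl⟩ := hu
    exact ⟨r * s, r * t, by module⟩

theorem estimates_of_close_to_graphSub {e : Fin 3 → EuclideanSpace ℝ (Fin 4)}
    (he : Orthonormal ℝ e) {n : EuclideanSpace ℝ (Fin 4)} (hn : ‖n‖ = 1)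
    (hne : ∀ i, inner ℝ n (e i) = 0) {Θ : Fin (3 - 2) → Fin 2 → ℝ} {R ε : ℝ} (hR : 0 ≤ R)
    (hΘ : ∀ j, |Θ 0 j| ≤ R) {u v : EuclideanSpace ℝ (Fin 4)}
    (hv : v ∈ graphSub 4 3 2 (by omega) e Θ) (huv : ‖u - v‖ ≤ ε) :
    |inner ℝ n u| ≤ ε ∧
    |inner ℝ (e 2) u - inner ℝ (e 0) u * Θ 0 0 - inner ℝ (e 1) u * Θ 0 1| ≤ (1 + 2 * R) * ε ∧
    ‖u‖ ≤ (3 + 2 * R) * ε + (1 + R) * (|inner ℝ (e 0) u| + |inner ℝ (e 1) u|) := by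
  obtain ⟨s, t, rfl⟩ := exists_coords_of_mem_graphSub hv
  obtain ⟨d, rfl⟩ : ∃ d, u = d + (s • e 0 + t • e 1 + (Θ 0 0 * s + Θ 0 1 * t) • e 2) :=
    ⟨_, (sub_add_cancel _ _).symm⟩
  rw [add_sub_cancel_right] at huv
  have hε : 0 ≤ ε := (norm_nonneg _).trans huv
  have hunit (x : EuclideanSpace ℝ (Fin 4)) (hx : ‖x‖ = 1) : |inner ℝ x d| ≤ ε := by
    have := abs_real_inner_le_norm x d
    rw [hx, one_mul] at this
    exact this.trans huv
  have h0 := hunit _ (he.1 0)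
  have h1 := hunit _ (he.1 1)
  have h2 := hunit _ (he.1 2)
  have hnd := hunit _ hn
  have hmul (x y : ℝ) (hx : |x| ≤ R) : |x * y| ≤ R * |y| := by
    rw [abs_mul]
    exact mul_le_mul_of_nonneg_right hx (abs_nonneg y)
  have hs : |s| ≤ |inner ℝ (e 0) d + s| + ε := by
    have := abs_sub (inner ℝ (e 0) d + s) (inner ℝ (e 0) d)
    rw [add_sub_cancel_left] at this
    linarith
  have ht : |t| ≤ |inner ℝ (e 1) d + t| + ε := by
    have := abs_sub (inner ℝ (e 1) d + t) (inner ℝ (e 1) d)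
    rw [add_sub_cancel_left] at this
    linarith
  have hu0 : inner ℝ (e 0) (d + (s • e 0 + t • e 1 + (Θ 0 0 * s + Θ 0 1 * t) • e 2)) =
      inner ℝ (e 0) d + s := by
    simp [inner_add_right, inner_smul_right, he.1 0,
      he.inner_eq_zero (show (0 : Fin 3) ≠ 1 by decide),
      he.inner_eq_zero (show (0 : Fin 3) ≠ 2 by decide)]
  have hu1 : inner ℝ (e 1) (d + (s • e 0 + t • e 1 + (Θ 0 0 * s + Θ 0 1 * t) • e 2)) =
      inner ℝ (e 1) d + t := by
    simp [inner_add_right, inner_smul_right, he.1 1,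
      he.inner_eq_zero (show (1 : Fin 3) ≠ 0 by decide),
      he.inner_eq_zero (show (1 : Fin 3) ≠ 2 by decide)]
  have hu2 : inner ℝ (e 2) (d + (s • e 0 + t • e 1 + (Θ 0 0 * s + Θ 0 1 * t) • e 2)) =
      inner ℝ (e 2) d + (Θ 0 0 * s + Θ 0 1 * t) := by
    simp [inner_add_right, inner_smul_right, he.1 2,
      he.inner_eq_zero (show (2 : Fin 3) ≠ 0 by decide),
      he.inner_eq_zero (show (2 : Fin 3) ≠ 1 by decide)]
  have hun : inner ℝ n (d + (s • e 0 + t • e 1 + (Θ 0 0 * s + Θ 0 1 * t) • e 2)) =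
      inner ℝ n d := by
    simp [inner_add_right, inner_smul_right, hne]
  rw [hu0, hu1, hu2, hun]
  refine ⟨hnd, ?_, ?_⟩
  · have hA := hmul _ (inner ℝ (e 0) d) (hΘ 0)
    have hB := hmul _ (inner ℝ (e 1) d) (hΘ 1)
    have hA' := mul_le_mul_of_nonneg_left h0 hR
    have hB' := mul_le_mul_of_nonneg_left h1 hR
    rw [show inner ℝ (e 2) d + (Θ 0 0 * s + Θ 0 1 * t) - (inner ℝ (e 0) d + s) * Θ 0 0
      - (inner ℝ (e 1) d + t) * Θ 0 1
      = inner ℝ (e 2) d - Θ 0 0 * inner ℝ (e 0) d - Θ 0 1 * inner ℝ (e 1) d by ring]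
    refine (abs_sub _ _).trans ?_
    have := abs_sub (inner ℝ (e 2) d) (Θ 0 0 * inner ℝ (e 0) d)
    linarith
  · have hA := hmul _ s (hΘ 0)
    have hB := hmul _ t (hΘ 1)
    have hs' := mul_le_mul_of_nonneg_left hs (by linarith : 0 ≤ 1 + R)
    have ht' := mul_le_mul_of_nonneg_left ht (by linarith : 0 ≤ 1 + R)
    have h3 := abs_add_le (Θ 0 0 * s) (Θ 0 1 * t)
    have h4 : ‖s • e 0 + t • e 1 + (Θ 0 0 * s + Θ 0 1 * t) • e 2‖
        ≤ |s| + |t| + |Θ 0 0 * s + Θ 0 1 * t| := by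
      refine norm_add₃_le.trans_eq ?_
      simp [norm_smul, he.1]
    have h5 := norm_add_le d (s • e 0 + t • e 1 + (Θ 0 0 * s + Θ 0 1 * t) • e 2)
    linarith

theorem one_half_le_two_rpow_neg_one_third : (1 / 2 : ℝ) ≤ 2 ^ (-(1 / 3 : ℝ)) := by
  rw [one_div, ← Real.rpow_neg_one]
  exact Real.rpow_le_rpow_of_exponent_le (by norm_num) (by norm_num)

theorem eq_zero_of_close_to_badlyApproximable {w : EuclideanSpace ℝ (Fin 4)} {c T : ℝ}
    (hc : 0 < c)
    (hbad : ∀ q : ℕ, 0 < q →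
      c * (q : ℝ) ^ (-(1 / 3 : ℝ)) ≤ ⨆ i : Fin 3, distToInt (w i.succ * (q : ℝ)))
    (hT : 1 ≤ T) {d : Fin 4 → ℤ} (hd0 : |(d 0 : ℝ)| ≤ 2 * T)
    (hd : ∀ i : Fin 3, |(d i.succ : ℝ) - w i.succ * d 0| ≤
      min 1 c / 4 * T ^ (-(1 / 3 : ℝ))) : d = 0 := by
  have hT0 : 0 < T := by linarith
  have hTp : 0 < T ^ (-(1 / 3 : ℝ)) := by positivity
  have hT1 : T ^ (-(1 / 3 : ℝ)) ≤ 1 := Real.rpow_le_one_of_one_le_of_nonpos hT (by norm_num)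
  have hq : d 0 = 0 := by
    by_contra hq
    have hdist (i : Fin 3) : distToInt (w i.succ * ((d 0).natAbs : ℝ)) ≤
        c / 4 * T ^ (-(1 / 3 : ℝ)) := by
      have h1 : |(d i.succ : ℝ) - w i.succ * d 0| ≤ c / 4 * T ^ (-(1 / 3 : ℝ)) :=
        (hd i).trans (by gcongr; exact min_le_right _ _)
      refine le_trans ?_ h1
      rw [distToInt, Nat.cast_natAbs]
      rcases abs_choice (d 0) with h | h
      · rw [h, abs_sub_comm (d i.succ : ℝ)]
        exact round_le _ _
      · rw [h]
        refine (round_le _ (-d i.succ)).trans_eq ?_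
        push_cast
        congr 1
        ring
    have h2 := (hbad (d 0).natAbs (Int.natAbs_pos.2 hq)).trans (ciSup_le hdist)
    have h3 : (2 * T) ^ (-(1 / 3 : ℝ)) ≤ ((d 0).natAbs : ℝ) ^ (-(1 / 3 : ℝ)) := by
      refine Real.rpow_le_rpow_of_nonpos (by exact_mod_cast Int.natAbs_pos.2 hq) ?_ (by norm_num)
      rwa [Nat.cast_natAbs, Int.cast_abs]
    have h4 := one_half_le_two_rpow_neg_one_third
    rw [Real.mul_rpow (by norm_num) hT0.le] at h3
    nlinarith [mul_le_mul_of_nonneg_right h4 hTp.le, mul_pos hc hTp]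
  funext i
  refine Fin.cases hq (fun i => ?_) i
  have h1 := hd i
  rw [hq] at h1
  have h2 : min 1 c / 4 ≤ 1 / 4 := by gcongr; exact min_le_left _ _
  have h3 : |(d i.succ : ℝ)| < 1 := by
    simp only [Int.cast_zero, mul_zero, sub_zero] at h1
    nlinarith
  exact Int.abs_lt_one_iff.1 (by exact_mod_cast h3)

theorem sum_mul_eq_sum_mul_sub {n w : EuclideanSpace ℝ (Fin 4)} (hw0 : w 0 = 1)
    (hnw : ∑ i, n i * w i = 0) (x : Fin 4 → ℝ) :
    ∑ i, n i * x i = ∑ i : Fin 3, n i.succ * (x i.succ - w i.succ * x 0) := by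
  rw [Fin.sum_univ_succ, hw0] at hnw
  rw [Fin.sum_univ_succ]
  simp only [mul_sub, Finset.sum_sub_distrib, ← mul_assoc, ← Finset.sum_mul]
  linear_combination x 0 * hnw

theorem exists_succ_ne_zero {n w : EuclideanSpace ℝ (Fin 4)} (hw0 : w 0 = 1) (hn : ‖n‖ = 1)
    (hnw : ∑ i, n i * w i = 0) : ∃ j : Fin 3, n j.succ ≠ 0 := by
  by_contra! h
  have h0 : n 0 = 0 := by simpa [Fin.sum_univ_succ (n := 3), hw0, h] using hnw
  have : n = 0 := by
    ext i
    exact Fin.cases h0 h i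
  simp [this] at hn

theorem exists_finset_of_close_lattice_points {w n : EuclideanSpace ℝ (Fin 4)} (hw0 : w 0 = 1)
    {c : ℝ} (hc : 0 < c)
    (hbad : ∀ q : ℕ, 0 < q →
      c * (q : ℝ) ^ (-(1 / 3 : ℝ)) ≤ ⨆ i : Fin 3, distToInt (w i.succ * (q : ℝ)))
    (hn : ‖n‖ = 1) (hnw : ∑ i, n i * w i = 0) :
    ∃ κ K : ℝ, 0 < κ ∧ 0 < K ∧ ∀ T : ℝ, 1 ≤ T → ∃ F : Finset (Fin 4 → ℤ),
      (F.card : ℝ) ≤ K * T ^ (8 / 3 : ℝ) ∧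
      ∀ z : Fin 4 → ℤ, (∀ i, |(z i : ℝ)| ≤ T) →
        |∑ i, n i * (z i : ℝ)| ≤ κ * T ^ (-(1 / 3 : ℝ)) → z ∈ F := by
  obtain ⟨j, hj⟩ := exists_succ_ne_zero hw0 hn hnw
  have hn1 (i : Fin 4) : |n i| ≤ 1 := hn ▸ PiLp.norm_apply_le n i
  have hj0 : 0 < |n j.succ| := abs_pos.2 hj
  have hc1 : 0 < min 1 c := lt_min one_pos hc
  set κ : ℝ := min 1 c * |n j.succ| / 16 with hκ
  have hκ0 : 0 < κ := by positivity
  set W : ℝ := 1 + ∑ i, |w i| with hW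
  have hwW (i : Fin 4) : |w i| ≤ W - 1 := by
    rw [hW, add_sub_cancel_left]
    exact Finset.single_le_sum (f := fun i => |w i|) (fun i _ => abs_nonneg _) (Finset.mem_univ i)
  have hW0 : 0 < W := by positivity
  refine ⟨κ, (2 * W / κ + 3) ^ 2, hκ0, by positivity, fun T hT => ?_⟩
  have hT0 : 0 < T := by linarith
  set r : ℝ := κ * T ^ (-(1 / 3 : ℝ)) with hr
  have hTp : 0 < T ^ (-(1 / 3 : ℝ)) := by positivity
  have hr0 : 0 < r := by positivity
  set p : (Fin 4 → ℤ) → Fin 3 → ℝ := fun z i => z i.succ - w i.succ * z 0 with hp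
  set φ : (Fin 4 → ℤ) → Fin 2 → ℤ := fun z i => ⌊p z (j.succAbove i) / r⌋ with hφ
  set M : ℤ := ⌈W * T / r⌉ with hM
  have hM0 : 0 ≤ M := by positivity
  set S : Set (Fin 4 → ℤ) := {z | (∀ i, |(z i : ℝ)| ≤ T) ∧ |∑ i, n i * (z i : ℝ)| ≤ r} with hS
  set G : Finset (Fin 2 → ℤ) := Fintype.piFinset fun _ => Finset.Icc (-M) M with hG
  have hmaps : Set.MapsTo φ S G := by
    rintro z ⟨hz, -⟩
    simp only [hG, Finset.mem_coe, Fintype.mem_piFinset, Finset.mem_Icc, hφ]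
    intro i
    have h1 : |p z (j.succAbove i)| ≤ W * T := by
      refine (abs_sub _ _).trans ?_
      rw [abs_mul]
      have := mul_le_mul (hwW (j.succAbove i).succ) (hz 0) (abs_nonneg _)
        ((abs_nonneg _).trans (hwW 0))
      linarith [hz (j.succAbove i).succ]
    have h2 : |p z (j.succAbove i) / r| ≤ M := by
      rw [abs_div, abs_of_pos hr0]
      exact (div_le_div_of_nonneg_right h1 hr0.le).trans (Int.le_ceil _)
    rw [abs_le] at h2
    refine ⟨Int.le_floor.2 (by push_cast; exact h2.1), ?_⟩
    exact_mod_cast (Int.floor_le _).trans h2.2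
  have hinj : Set.InjOn φ S := by
    rintro z ⟨hz, hz'⟩ y ⟨hy, hy'⟩ hzy
    have hclose (i : Fin 2) : |p (z - y) (j.succAbove i)| ≤ r := by
      have h := Int.abs_sub_lt_one_of_floor_eq_floor (congrFun hzy i)
      rw [← sub_div, abs_div, abs_of_pos hr0, div_lt_one hr0] at h
      have hsub : p (z - y) (j.succAbove i) = p z (j.succAbove i) - p y (j.succAbove i) := by
        simp only [hp, Pi.sub_apply]
        push_cast
        ring
      exact hsub ▸ h.le
    have hform : ∑ i, n i * ((z - y) i : ℝ) =
        ∑ i, n i * (z i : ℝ) - ∑ i, n i * (y i : ℝ) := by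
      rw [← Finset.sum_sub_distrib]
      refine Finset.sum_congr rfl fun i _ => ?_
      rw [Pi.sub_apply]
      push_cast
      ring
    have hsum : ∑ i, n i * ((z - y) i : ℝ) = ∑ i : Fin 3, n i.succ * p (z - y) i :=
      sum_mul_eq_sum_mul_sub hw0 hnw (fun i => ((z - y) i : ℝ))
    rw [hform, Fin.sum_univ_succAbove _ j, Fin.sum_univ_two] at hsum
    have hterm (i : Fin 2) :
        |n (j.succAbove i).succ * p (z - y) (j.succAbove i)| ≤ r := by
      rw [abs_mul]
      exact (mul_le_of_le_one_left (abs_nonneg _) (hn1 _)).trans (hclose i)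
    have hj4 : |n j.succ * p (z - y) j| ≤ 4 * r := by
      have h0 := hterm 0
      have h1 := hterm 1
      rw [abs_le] at hz' hy' h0 h1 ⊢
      constructor <;> linarith
    have hkey : 4 * r = |n j.succ| * (min 1 c / 4 * T ^ (-(1 / 3 : ℝ))) := by
      rw [hr, hκ]
      ring
    have hbound : 4 * r ≤ min 1 c / 4 * T ^ (-(1 / 3 : ℝ)) :=
      hkey.trans_le (mul_le_of_le_one_left (by positivity) (hn1 _))
    refine sub_eq_zero.1 (eq_zero_of_close_to_badlyApproximable hc hbad hT ?_ ?_)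
    · have := abs_sub (z 0 : ℝ) (y 0)
      rw [Pi.sub_apply]
      push_cast
      linarith [hz 0, hy 0]
    · intro i
      change |p (z - y) i| ≤ _
      rcases eq_or_ne i j with rfl | hij
      · rw [abs_mul, hkey] at hj4
        exact le_of_mul_le_mul_left hj4 hj0
      · obtain ⟨k, rfl⟩ := Fin.exists_succAbove_eq hij
        linarith [hclose k]
  have hfin : S.Finite := Set.Finite.of_injOn hmaps hinj G.finite_toSet
  refine ⟨hfin.toFinset, ?_, fun z hz hz' => hfin.mem_toFinset.2 ⟨hz, hz'⟩⟩
  have hcard : hfin.toFinset.card ≤ G.card :=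
    Finset.card_le_card_of_injOn φ (by simpa using hmaps) (by simpa using hinj)
  have hGcard : (G.card : ℝ) = (2 * (M : ℝ) + 1) ^ 2 := by
    have h1 : ((M + 1 - -M).toNat : ℤ) = 2 * M + 1 := by omega
    have h2 : (((M + 1 - -M).toNat : ℕ) : ℝ) = 2 * (M : ℝ) + 1 := by exact_mod_cast h1
    rw [hG, Fintype.card_piFinset_const, Int.card_Icc, Nat.cast_pow, h2]
  have hMle : (M : ℝ) ≤ W * T / r + 1 := (Int.ceil_lt_add_one _).le
  have hT43 : (1 : ℝ) ≤ T ^ (4 / 3 : ℝ) := Real.one_le_rpow hT (by norm_num)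
  have hTr : W * T / r = W / κ * T ^ (4 / 3 : ℝ) := by
    have h : T = T ^ (4 / 3 : ℝ) * T ^ (-(1 / 3 : ℝ)) := by
      rw [← Real.rpow_add hT0]
      norm_num
    rw [hr]
    nth_rewrite 1 [h]
    field_simp
  have hM2 : 2 * (M : ℝ) + 1 ≤ (2 * W / κ + 3) * T ^ (4 / 3 : ℝ) := by
    rw [hTr] at hMle
    have : (2 * W / κ + 3) * T ^ (4 / 3 : ℝ) =
      2 * (W / κ * T ^ (4 / 3 : ℝ)) + 3 * T ^ (4 / 3 : ℝ) := by ring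
    linarith
  have hM0' : (0 : ℝ) ≤ M := by exact_mod_cast hM0
  calc (hfin.toFinset.card : ℝ) ≤ G.card := by exact_mod_cast hcard
    _ = (2 * (M : ℝ) + 1) ^ 2 := hGcard
    _ ≤ ((2 * W / κ + 3) * T ^ (4 / 3 : ℝ)) ^ 2 := by gcongr
    _ = (2 * W / κ + 3) ^ 2 * T ^ (8 / 3 : ℝ) := by
      rw [mul_pow, ← Real.rpow_natCast (T ^ (4 / 3 : ℝ)), ← Real.rpow_mul hT0.le]
      norm_num

theorem intVec_apply {d : ℕ} (z : Fin d → ℤ) (i : Fin d) : intVec z i = z i := rfl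

theorem abs_apply_le_supNorm {d : ℕ} (v : EuclideanSpace ℝ (Fin d)) (i : Fin d) :
    |v i| ≤ supNorm v :=
  le_ciSup (f := fun i => |v i|) (Set.finite_range _).bddAbove i

theorem supNorm_le_norm {d : ℕ} (v : EuclideanSpace ℝ (Fin d)) : supNorm v ≤ ‖v‖ :=
  Real.iSup_le (fun i => PiLp.norm_apply_le v i) (norm_nonneg v)

theorem one_le_supNorm_intVec {d : ℕ} {z : Fin d → ℤ} (hz : z ≠ 0) : 1 ≤ supNorm (intVec z) := by
  obtain ⟨i, hi⟩ := Function.ne_iff.1 hz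
  refine le_trans ?_ (abs_apply_le_supNorm _ i)
  rw [intVec_apply]
  rw [← Int.cast_abs]
  exact_mod_cast Int.one_le_abs hi

theorem exists_unit_normal {A : Submodule ℝ (EuclideanSpace ℝ (Fin 4))}
    (hdim : Module.finrank ℝ A = 3) :
    ∃ n : EuclideanSpace ℝ (Fin 4), ‖n‖ = 1 ∧ ∀ v ∈ A, inner ℝ n v = 0 := by
  have hA : Aᗮ ≠ ⊥ := by
    intro h
    rw [Submodule.orthogonal_eq_bot_iff] at h
    rw [h, finrank_top, finrank_euclideanSpace_fin] at hdim
    omega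
  obtain ⟨x, hx, hx0⟩ := Submodule.exists_mem_ne_zero_of_ne_bot hA
  refine ⟨(‖x‖⁻¹ : ℝ) • x, norm_smul_inv_norm (𝕜 := ℝ) hx0, fun v hv => ?_⟩
  rw [real_inner_smul_left, (Submodule.mem_orthogonal' A x).1 hx v hv, mul_zero]

theorem inner_eq_sum_mul {d : ℕ} (x y : EuclideanSpace ℝ (Fin d)) :
    inner ℝ x y = ∑ i, x i * y i := by
  simp [PiLp.inner_apply, mul_comm]

theorem mem_strip_of_infDist_lt {e : Fin 3 → EuclideanSpace ℝ (Fin 4)}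
    (he : Orthonormal ℝ e) {n : EuclideanSpace ℝ (Fin 4)} (hn : ‖n‖ = 1)
    (hne : ∀ i, inner ℝ n (e i) = 0) {Θ : Fin (3 - 2) → Fin 2 → ℝ} {R ε : ℝ} (hR : 0 ≤ R)
    (hΘ : ∀ j, |Θ 0 j| ≤ R) (hε : (3 + 2 * R) * ε ≤ 1 / 2) {z : Fin 4 → ℤ} {Q : ℝ} (hQ : 1 ≤ Q)
    (hzQ : Q ≤ supNorm (intVec z))
    (hlt : Metric.infDist (intVec z)
      ((graphSub 4 3 2 (by omega) e Θ : Submodule ℝ (EuclideanSpace ℝ (Fin 4))) :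
        Set (EuclideanSpace ℝ (Fin 4))) < ε) :
    |∑ i, n i * (z i : ℝ)| ≤ ε ∧
    Q / (4 * (1 + R)) ≤ max |inner ℝ (e 0) (intVec z)| |inner ℝ (e 1) (intVec z)| ∧
    |inner ℝ (e 2) (intVec z) - inner ℝ (e 0) (intVec z) * Θ 0 0 -
      inner ℝ (e 1) (intVec z) * Θ 0 1| ≤ (1 + 2 * R) * ε := by
  obtain ⟨v, hv, hzv⟩ := (Metric.infDist_lt_iff ⟨0, Submodule.zero_mem _⟩).1 hlt
  rw [dist_eq_norm] at hzv
  obtain ⟨h1, h2, h3⟩ := estimates_of_close_to_graphSub he hn hne hR hΘ hv hzv.le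
  refine ⟨by rwa [inner_eq_sum_mul] at h1, ?_, h2⟩
  rw [div_le_iff₀ (by positivity)]
  have hle := hzQ.trans (supNorm_le_norm (intVec z))
  set y₀ := |inner ℝ (e 0) (intVec z)|
  set y₁ := |inner ℝ (e 1) (intVec z)|
  have h4 : (1 + R) * (y₀ + y₁) ≤ (1 + R) * (2 * max y₀ y₁) :=
    mul_le_mul_of_nonneg_left (by linarith [le_max_left y₀ y₁, le_max_right y₀ y₁])
      (by linarith)
  linarith

theorem volume_biUnion_strip_le (e : Fin 3 → EuclideanSpace ℝ (Fin 4))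
    (F : Finset (Fin 4 → ℤ)) {N m η R : ℝ} (hF : (F.card : ℝ) ≤ N) (hm : 0 < m)
    (hη : 0 ≤ η) :
    volume (⋃ z ∈ F, {Θ : Fin (3 - 2) → Fin 2 → ℝ |
      m ≤ max |inner ℝ (e 0) (intVec z)| |inner ℝ (e 1) (intVec z)| ∧ (∀ j, |Θ 0 j| ≤ R) ∧
      |inner ℝ (e 2) (intVec z) - inner ℝ (e 0) (intVec z) * Θ 0 0 -
        inner ℝ (e 1) (intVec z) * Θ 0 1| ≤ η}) ≤ ENNReal.ofReal (N * (4 * R * η / m)) := by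
  refine (measure_biUnion_finset_le _ _).trans
    ((Finset.sum_le_card_nsmul _ _ _ fun z _ => volume_strip_le hm hη).trans ?_)
  rw [nsmul_eq_mul, ENNReal.ofReal_mul ((Nat.cast_nonneg _).trans hF)]
  gcongr
  rw [← ENNReal.ofReal_natCast]
  exact ENNReal.ofReal_le_ofReal hF

theorem eq_zero_of_forall_le_ofReal_mul {a : ENNReal} {C ρ₀ : ℝ} (hρ₀ : 0 < ρ₀)
    (h : ∀ ρ, 0 < ρ → ρ ≤ ρ₀ → a ≤ ENNReal.ofReal (C * ρ)) : a = 0 := by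
  have hcont : Continuous fun ρ : ℝ => ENNReal.ofReal (C * ρ) :=
    ENNReal.continuous_ofReal.comp (continuous_const_mul C)
  have hlim : Tendsto (fun ρ : ℝ => ENNReal.ofReal (C * ρ)) (nhdsWithin 0 (Set.Ioi 0))
      (nhds 0) := by
    simpa using (hcont.tendsto 0).mono_left nhdsWithin_le_nhds
  refine nonpos_iff_eq_zero.1 (ge_of_tendsto hlim ?_)
  filter_upwards [Ioc_mem_nhdsGT hρ₀] with ρ hρ using h ρ hρ.1 hρ.2

theorem volume_not_badlyApproximable_eq_zero
    {e : Fin 3 → EuclideanSpace ℝ (Fin 4)} (he : Orthonormal ℝ e)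
    {w n : EuclideanSpace ℝ (Fin 4)} (hw0 : w 0 = 1) {c : ℝ} (hc : 0 < c)
    (hbad : ∀ q : ℕ, 0 < q →
      c * (q : ℝ) ^ (-(1 / 3 : ℝ)) ≤ ⨆ i : Fin 3, distToInt (w i.succ * (q : ℝ)))
    (hn : ‖n‖ = 1) (hne : ∀ i, inner ℝ n (e i) = 0) (hnw : inner ℝ n w = 0)
    {β R : ℝ} (hβ : 5 / 3 < β) (hR : 0 ≤ R) :
    volume {Θ : Fin (3 - 2) → Fin 2 → ℝ | (∀ j, |Θ 0 j| ≤ R) ∧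
      ∀ ρ : ℝ, 0 < ρ → ∃ z : Fin 4 → ℤ, z ≠ 0 ∧
        Metric.infDist (intVec z)
          ((graphSub 4 3 2 (by omega) e Θ : Submodule ℝ (EuclideanSpace ℝ (Fin 4))) :
            Set (EuclideanSpace ℝ (Fin 4))) < ρ * supNorm (intVec z) ^ (-β)} = 0 := by
  rw [inner_eq_sum_mul] at hnw
  obtain ⟨κ, K, hκ, hK, hF⟩ := exists_finset_of_close_lattice_points hw0 hc hbad hn hnw
  have hT (k : ℕ) : (1 : ℝ) ≤ 2 ^ (k + 1) := one_le_pow₀ one_le_two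
  choose F hcard hmem using fun k : ℕ => hF (2 ^ (k + 1)) (hT k)
  set x : ℝ := 2 ^ (5 / 3 - β) with hx
  have hx0 : 0 ≤ x := by positivity
  have hx1 : x < 1 := Real.rpow_lt_one_of_one_lt_of_neg one_lt_two (by linarith)
  set C : ℝ := K * 2 ^ (8 / 3 : ℝ) * (16 * R * (1 + 2 * R) * (1 + R)) with hC
  have hC0 : 0 ≤ C := by positivity
  refine eq_zero_of_forall_le_ofReal_mul (C := C * (1 - x)⁻¹)
    (ρ₀ := min (κ / 2) (1 / (2 * (3 + 2 * R)))) (by positivity) fun ρ hρ hρ' => ?_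
  have hρκ : ρ ≤ κ / 2 := hρ'.trans (min_le_left _ _)
  have hρR : (3 + 2 * R) * ρ ≤ 1 / 2 := by
    have := hρ'.trans (min_le_right _ _)
    rw [le_div_iff₀ (by positivity)] at this
    linarith
  set ε : ℕ → ℝ := fun k => ρ * ((2 : ℝ) ^ k) ^ (-β) with hε
  have hε0 (k : ℕ) : 0 ≤ ε k := by positivity
  have hερ (k : ℕ) : ε k ≤ ρ := mul_le_of_le_one_right hρ.le
    (Real.rpow_le_one_of_one_le_of_nonpos (one_le_pow₀ one_le_two) (by linarith))
  have hεκ (k : ℕ) : ε k ≤ κ * ((2 : ℝ) ^ (k + 1)) ^ (-(1 / 3 : ℝ)) := by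
    have h1 : ((2 : ℝ) ^ k) ^ (-β) ≤ ((2 : ℝ) ^ k) ^ (-(1 / 3 : ℝ)) :=
      Real.rpow_le_rpow_of_exponent_le (one_le_pow₀ one_le_two) (by linarith)
    have h2 := one_half_le_two_rpow_neg_one_third
    rw [pow_succ, Real.mul_rpow (by positivity) (by norm_num)]
    calc ε k ≤ κ / 2 * ((2 : ℝ) ^ k) ^ (-(1 / 3 : ℝ)) := mul_le_mul hρκ h1 (by positivity) (by positivity)
      _ = κ * (((2 : ℝ) ^ k) ^ (-(1 / 3 : ℝ)) * (1 / 2)) := by ring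
      _ ≤ _ := by gcongr
  refine (measure_mono (t := ⋃ k : ℕ, ⋃ z ∈ F k, {Θ : Fin (3 - 2) → Fin 2 → ℝ |
      2 ^ k / (4 * (1 + R)) ≤ max |inner ℝ (e 0) (intVec z)| |inner ℝ (e 1) (intVec z)| ∧
      (∀ j, |Θ 0 j| ≤ R) ∧ |inner ℝ (e 2) (intVec z) - inner ℝ (e 0) (intVec z) * Θ 0 0 -
        inner ℝ (e 1) (intVec z) * Θ 0 1| ≤ (1 + 2 * R) * ε k}) ?_).trans ?_
  · rintro Θ ⟨hΘ, hΘ'⟩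
    obtain ⟨z, hz0, hz⟩ := hΘ' ρ hρ
    obtain ⟨k, hk, hk'⟩ := exists_nat_pow_near (one_le_supNorm_intVec hz0) one_lt_two
    have hzε := hz.trans_le (mul_le_mul_of_nonneg_left
      (Real.rpow_le_rpow_of_nonpos (by positivity) hk (by linarith)) hρ.le)
    obtain ⟨h1, h2, h3⟩ := mem_strip_of_infDist_lt (ε := ε k) he hn hne hR hΘ
      ((mul_le_mul_of_nonneg_left (hερ k) (by positivity)).trans hρR)
      (one_le_pow₀ one_le_two) hk hzε
    simp only [Set.mem_iUnion]
    exact ⟨k, z, hmem k z (fun i => (abs_apply_le_supNorm (intVec z) i).trans hk'.le)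
      (h1.trans (hεκ k)), h2, hΘ, h3⟩
  · have hterm (k : ℕ) : K * ((2 : ℝ) ^ (k + 1)) ^ (8 / 3 : ℝ) *
        (4 * R * ((1 + 2 * R) * ε k) / (2 ^ k / (4 * (1 + R)))) = C * ρ * x ^ k := by
      have hxk : x ^ k = ((2 : ℝ) ^ k) ^ (8 / 3 : ℝ) * ((2 : ℝ) ^ k) ^ (-β) / 2 ^ k := by
        rw [hx, ← Real.rpow_natCast, ← Real.rpow_mul zero_le_two, mul_comm,
          Real.rpow_mul zero_le_two, Real.rpow_natCast, ← Real.rpow_add (by positivity),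
          ← Real.rpow_sub_one (by positivity)]
        congr 1
        ring
      rw [hxk, pow_succ, Real.mul_rpow (by positivity) (by norm_num), hC, hε]
      field_simp
      ring
    calc _ ≤ ∑' k : ℕ, ENNReal.ofReal (C * ρ * x ^ k) := by
          refine (measure_iUnion_le _).trans (ENNReal.tsum_le_tsum fun k => ?_)
          rw [← hterm k]
          exact volume_biUnion_strip_le e (F k) (hcard k) (by positivity)
            (mul_nonneg (by positivity) (hε0 k))
      _ = ENNReal.ofReal (C * (1 - x)⁻¹ * ρ) := by
          rw [← ENNReal.ofReal_tsum_of_nonneg (fun k => by positivity)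
            ((summable_geometric_of_lt_one hx0 hx1).mul_left _), tsum_mul_left,
            tsum_geometric_of_lt_one hx0 hx1, mul_right_comm]

/-- the example of the paper: if a `3`-dimensional subspace `A ⊆ ℝ^4` contains a
vector `w = (1, w₁, w₂, w₃)` with `max_{1≤i≤3} ‖w_i q‖ ≥ c q^{−1/3}` for all positive integers
`q`, then for every `β > 5/3` and almost every `Θ ∈ ℝ^{1×2}` there is `ρ > 0` such that the
`2`-dimensional subspace `C(Θ) ⊆ A` is `ρT^{−β}`-badly approximable. -/
theorem stmt_13 (A : Submodule ℝ (EuclideanSpace ℝ (Fin 4)))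
    (hdimA : Module.finrank ℝ A = 3)
    (e : Fin 3 → EuclideanSpace ℝ (Fin 4)) (he : Orthonormal ℝ e)
    (hspan : Submodule.span ℝ (Set.range e) = A)
    (w : EuclideanSpace ℝ (Fin 4)) (hwA : w ∈ A) (hw0 : w 0 = 1)
    (cst : ℝ) (hcst : 0 < cst)
    (hbad : ∀ q : ℕ, 0 < q →
      cst * (q : ℝ) ^ (-(1 / 3 : ℝ)) ≤ ⨆ i : Fin 3, distToInt (w i.succ * (q : ℝ))) :
    ∀ β : ℝ, 5 / 3 < β →
      ∀ᵐ Θ ∂(volume : Measure (Fin (3 - 2) → Fin 2 → ℝ)),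
        ∃ ρ : ℝ, 0 < ρ ∧ ∀ z : Fin 4 → ℤ, z ≠ 0 →
          ρ * supNorm (intVec z) ^ (-β) ≤
            Metric.infDist (intVec z)
              ((graphSub 4 3 2 (by omega) e Θ : Submodule ℝ (EuclideanSpace ℝ (Fin 4))) :
                Set (EuclideanSpace ℝ (Fin 4))) := by
  intro β hβ
  obtain ⟨n, hn, hnA⟩ := exists_unit_normal hdimA
  have hne (i : Fin 3) : inner ℝ n (e i) = 0 :=
    hnA _ (hspan ▸ Submodule.subset_span (Set.mem_range_self i))
  have hnull (N : ℕ) := measure_eq_zero_iff_ae_notMem.1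
    (volume_not_badlyApproximable_eq_zero he hw0 hcst hbad hn hne (hnA w hwA) hβ N.cast_nonneg)
  filter_upwards [ae_all_iff.2 hnull] with Θ hΘ
  obtain ⟨N, hN⟩ := exists_nat_ge (max |Θ 0 0| |Θ 0 1|)
  by_contra! hcon
  exact hΘ N ⟨Fin.forall_fin_two.2 (max_le_iff.1 hN), hcon⟩

end
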